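/- Assume m ≥ 2 and set E_1 = E + (1/y)·E^1 ⊆ E ⊗_R K. Then (1/y)·(((1/t)·E^2) ∩ E_1) + E_1 = (1/y^2)·(A_0 ⊕ ⋯ ⊕ A_{m−2}) ⊕ (1/y)·A_{m−1} ⊕ A_m; that is, the second echelon modification E_2 obtained from the recursion E_1^1 = E^2(δ_1) ∩ E_1, E_2 = E_1^1(dD_2) + E_1 coincides with the explicit direct sum formula. -/

import Mathlib

open Pointwise

namespace Submodule

/-- For independent submodules, the intersection of two direct sums of submodules of the members
is computed componentwise. -/
theorem iSup_inf_iSup_of_iSupIndep {R V ι : Type*} [Ring R] [AddCommGroup V] [Module R V]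
    [Fintype ι] {B P Q : ι → Submodule R V} (hB : iSupIndep B) (hP : P ≤ B) (hQ : Q ≤ B) :
    (⨆ k, P k) ⊓ (⨆ k, Q k) = ⨆ k, P k ⊓ Q k := by
  refine le_antisymm ?_ (le_inf (iSup_mono fun k => inf_le_left) (iSup_mono fun k => inf_le_right))
  rintro v ⟨hvP, hvQ⟩
  have key (S : ι → Submodule R V) (hv : v ∈ ⨆ k, S k) : ∃ μ : ∀ k, S k, ∑ k, (μ k : V) = v :=
    (mem_iSup_finset_iff_exists_sum (s := Finset.univ) S v).1 (by simpa using hv)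
  obtain ⟨a, ha⟩ := key P hvP
  obtain ⟨b, hb⟩ := key Q hvQ
  have hab := (iSupIndep_iff_finsetSum_eq_imp_eq B).1 hB Finset.univ (fun k => a k) (fun k => b k)
    (fun k _ => ⟨hP k (a k).2, hQ k (b k).2⟩) (ha.trans hb.symm)
  rw [← ha]
  refine sum_mem fun k _ => mem_iSup_of_mem k ⟨(a k).2, ?_⟩
  have h : (a k : V) = b k := hab k (Finset.mem_univ k)
  rw [h]
  exact (b k).2

variable {R K V : Type*} [CommRing R] [Field K] [Algebra R K]
  [AddCommGroup V] [Module K V] [Module R V] [IsScalarTower R K V]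

theorem algebraMap_smul_pointwise (r : R) (N : Submodule R V) :
    algebraMap R K r • N = r • N := by
  ext v
  simp [mem_smul_pointwise_iff_exists]

theorem le_inv_algebraMap_smul {r : R} (hr : algebraMap R K r ≠ 0) (N : Submodule R V) :
    N ≤ (algebraMap R K r)⁻¹ • N := by
  intro v hv
  rw [← inv_smul_smul₀ hr v, algebraMap_smul]
  exact smul_mem_pointwise_smul _ _ _ (N.smul_mem r hv)

theorem iSupIndep_smul {ι : Type*} {c : K} (hc : c ≠ 0) {A : ι → Submodule R V}
    (hA : iSupIndep A) : iSupIndep fun k => c • A k :=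
  LinearMap.iSupIndep_map (DistribSMul.toLinearMap R V c) (smul_right_injective V hc) hA

end Submodule

/-- Local scalar form of the recursion for the second echelon
modification: `(1/y)·(((1/t)·E²) ∩ E₁) + E₁ = (1/y²)·(A₀ ⊕ ⋯ ⊕ A_{m−2}) ⊕ (1/y)·A_{m−1} ⊕ A_m`. -/
theorem echelon_second_modification_formula
    {R K V : Type*} [CommRing R] [IsDomain R] [UniqueFactorizationMonoid R]
    [Field K] [Algebra R K] [IsFractionRing R K]
    [AddCommGroup V] [Module K V] [Module R V] [IsScalarTower R K V]
    (m : ℕ) (hm : 2 ≤ m)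
    (t x y : R) (hx : x ≠ 0) (hy : y ≠ 0) (ht : t = x * y) (hxy : IsRelPrime x y)
    (A : ℕ → Submodule R V)
    (hAfree : ∀ k ≤ m, Module.Free R ↥(A k))
    (hAfin : ∀ k ≤ m, Module.Finite R ↥(A k))
    (hindep : iSupIndep fun k : Fin (m + 1) => A k)
    (E : Submodule R V) (hE : E = ⨆ k : Fin (m + 1), A k)
    (Epow : ℕ → Submodule R V)
    (hEpow : ∀ i ≤ m, Epow i = ⨆ k : Fin (m + 1), (t ^ (i + (k : ℕ) - m)) • A k)
    (E1 : Submodule R V) (hE1 : E1 = E ⊔ (algebraMap R K y)⁻¹ • Epow 1) :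
    ((algebraMap R K y)⁻¹ • (((algebraMap R K t)⁻¹ • Epow 2) ⊓ E1)) ⊔ E1
      = (((algebraMap R K y)⁻¹ ^ 2) • ⨆ k ∈ Finset.range (m - 1), A k)
          ⊔ (algebraMap R K y)⁻¹ • A (m - 1) ⊔ A m := by
  subst ht hE hE1
  have hX : algebraMap R K x ≠ 0 := by simpa using hx
  have hY : algebraMap R K y ≠ 0 := by simpa using hy
  have hT : algebraMap R K (x * y) ≠ 0 := by simp [hx, hy]
  rw [hEpow 1 (by omega), hEpow 2 hm]
  simp only [Submodule.smul_iSup', ← iSup_sup_eq]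
  have leY (N : Submodule R V) : N ≤ (algebraMap R K y)⁻¹ • N :=
    Submodule.le_inv_algebraMap_smul hY N
  have leX (N : Submodule R V) :
      (algebraMap R K y)⁻¹ • N ≤ (algebraMap R K (x * y))⁻¹ • N := by
    rw [map_mul, mul_inv, mul_smul]
    exact Submodule.le_inv_algebraMap_smul hX _
  have leT (n : ℕ) (N : Submodule R V) : (x * y) ^ n • N ≤ N :=
    Submodule.smul_le_self_of_tower _ _
  have cancelT (N : Submodule R V) : (algebraMap R K (x * y))⁻¹ • (x * y) • N = N := by
    rw [← Submodule.algebraMap_smul_pointwise (K := K), inv_smul_smul₀ hT]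
  have cancelY (N : Submodule R V) : (algebraMap R K y)⁻¹ • (x * y) • N ≤ N := by
    rw [mul_comm, mul_smul, ← Submodule.algebraMap_smul_pointwise (K := K) y, inv_smul_smul₀ hY]
    exact Submodule.smul_le_self_of_tower _ _
  have low (N : Submodule R V) : N ⊔ (algebraMap R K y)⁻¹ • N = (algebraMap R K y)⁻¹ • N :=
    sup_eq_right.2 (leY N)
  rw [Submodule.iSup_inf_iSup_of_iSupIndep
    (Submodule.iSupIndep_smul (inv_ne_zero hT) hindep)
    (fun k => smul_mono_right _ (leT _ _))
    (fun k => sup_le ((leY _).trans (leX _)) ((smul_mono_right _ (leT _ _)).trans (leX _)))]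
  simp only [Submodule.smul_iSup', ← iSup_sup_eq]
  have comp (k : ℕ) (hk : k ≤ m) :
      (algebraMap R K y)⁻¹ • ((algebraMap R K (x * y))⁻¹ • (x * y) ^ (2 + k - m) • A k ⊓
          (A k ⊔ (algebraMap R K y)⁻¹ • (x * y) ^ (1 + k - m) • A k)) ⊔
        (A k ⊔ (algebraMap R K y)⁻¹ • (x * y) ^ (1 + k - m) • A k) =
      ((algebraMap R K y)⁻¹ ^ min 2 (m - k)) • A k := by
    obtain h | rfl | rfl : k + 2 ≤ m ∨ m = k + 1 ∨ m = k := by omega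
    · rw [show 2 + k - m = 0 by omega, show 1 + k - m = 0 by omega,
        show min 2 (m - k) = 2 by omega, pow_zero, one_smul, low, inf_eq_right.2 (leX _),
        pow_two, mul_smul]
      exact sup_eq_left.2 (leY _)
    · rw [show 2 + k - (k + 1) = 1 by omega, show 1 + k - (k + 1) = 0 by omega,
        show min 2 (k + 1 - k) = 1 by omega, pow_zero, one_smul, low, pow_one, cancelT,
        inf_eq_left.2 (leY _), pow_one, sup_idem]
    · rw [show 2 + m - m = 2 by omega, show 1 + m - m = 1 by omega,
        show min 2 (m - m) = 0 by omega, pow_zero, one_smul, pow_one,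
        sup_eq_left.2 (cancelY _), pow_two, mul_smul, cancelT]
      exact sup_eq_right.2 ((smul_mono_right _ inf_le_left).trans (cancelY _))
  rw [iSup_congr fun k : Fin (m + 1) => comp k (by omega)]
  apply le_antisymm
  · refine iSup_le fun ⟨k, hk⟩ => ?_
    obtain h | rfl | rfl : k + 2 ≤ m ∨ m = k + 1 ∨ m = k := by omega
    · rw [show min 2 (m - k) = 2 by omega]
      exact le_sup_of_le_left (le_sup_of_le_left
        (le_iSup₂_of_le k (Finset.mem_range.2 (by omega)) le_rfl))
    · simp [le_sup_of_le_left]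
    · simp
  · refine sup_le (sup_le (iSup₂_le fun k hk => ?_) ?_) ?_
    · rw [Finset.mem_range] at hk
      refine le_iSup_of_le ⟨k, by omega⟩ ?_
      rw [show min 2 (m - k) = 2 by omega]
    · refine le_iSup_of_le ⟨m - 1, by omega⟩ ?_
      rw [show min 2 (m - (m - 1)) = 1 by omega, pow_one]
    · refine le_iSup_of_le ⟨m, by omega⟩ ?_
      simp
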